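/- arXiv:1206.1954 — 4 statements merged into one kernel-verified Lean document; each statement's English description precedes it below -/
import Mathlib

section
/- Let r ∈ ℝ, η₁, η₂ ∈ [0,1], φ ∈ ℝ. Work with 8 quadratures ordered (x₁,p₁,x₂,p₂,x_{e₁},p_{e₁},x_{e₂},p_{e₂}). Let γ_in be the 8×8 block-diagonal matrix γ₀ ⊕ I₄, where γ₀ is the 4×4 two-mode squeezed vacuum covariance matrix with diagonal blocks cosh(2r)·I₂ and off-diagonal blocks sinh(2r)·diag(1,−1). Let M_φ be the 8×8 matrix acting as the rotation [[cos φ, sin φ],[−sin φ, cos φ]] on (x₁,p₁) and as the identity on the other six quadratures, and let M_loss be the 8×8 matrix acting on each pair of quadratures as x_i ↦ √η_i x_i − √(1−η_i) x_{e_i}, p_i ↦ √η_i p_i − √(1−η_i) p_{e_i}, x_{e_i} ↦ √(1−η_i) x_i + √η_i x_{e_i}, p_{e_i} ↦ √(1−η_i) p_i + √η_i p_{e_i} (i = 1,2). Then the upper-left 4×4 block of M_loss M_φ γ_in M_φᵀ M_lossᵀ equals the matrix γ'(φ) with rows [[d₁, 0, a cos φ, −a sin φ],[0, d₁, −a sin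 φ, −a cos φ],[a cos φ, −a sin φ, d₂, 0],[−a sin φ, −a cos φ, 0, d₂]], where d₁ = 1 + 2η₁ sinh²r, d₂ = 1 + 2η₂ sinh²r, and a = √(η₁η₂) sinh(2r). -/
open Real Matrix

/-- Input covariance matrix `γ₀ ⊕ I₄` in quadrature ordering
`(x₁,p₁,x₂,p₂,x_{e₁},p_{e₁},x_{e₂},p_{e₂})`, where `γ₀` is the two-mode squeezed
vacuum covariance matrix with diagonal blocks `cosh(2r)·I₂` and off-diagonal
blocks `sinh(2r)·diag(1,-1)`. -/
noncomputable def gammaIn (r : ℝ) : Matrix (Fin 8) (Fin 8) ℝ :=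
  !![Real.cosh (2*r), 0, Real.sinh (2*r), 0, 0, 0, 0, 0;
     0, Real.cosh (2*r), 0, -Real.sinh (2*r), 0, 0, 0, 0;
     Real.sinh (2*r), 0, Real.cosh (2*r), 0, 0, 0, 0, 0;
     0, -Real.sinh (2*r), 0, Real.cosh (2*r), 0, 0, 0, 0;
     0, 0, 0, 0, 1, 0, 0, 0;
     0, 0, 0, 0, 0, 1, 0, 0;
     0, 0, 0, 0, 0, 0, 1, 0;
     0, 0, 0, 0, 0, 0, 0, 1]

/-- Phase shifter: rotation by `φ` on the quadratures `(x₁,p₁)`, identity on the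
remaining six quadratures. -/
noncomputable def Mphase (φ : ℝ) : Matrix (Fin 8) (Fin 8) ℝ :=
  !![Real.cos φ, Real.sin φ, 0, 0, 0, 0, 0, 0;
     -Real.sin φ, Real.cos φ, 0, 0, 0, 0, 0, 0;
     0, 0, 1, 0, 0, 0, 0, 0;
     0, 0, 0, 1, 0, 0, 0, 0;
     0, 0, 0, 0, 1, 0, 0, 0;
     0, 0, 0, 0, 0, 1, 0, 0;
     0, 0, 0, 0, 0, 0, 1, 0;
     0, 0, 0, 0, 0, 0, 0, 1]

/-- Photon loss: fictitious beam splitters of transmissivities `η₁, η₂` mixing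
each arm mode with its vacuum environment mode:
`x_i ↦ √η_i x_i − √(1−η_i) x_{e_i}`, `p_i ↦ √η_i p_i − √(1−η_i) p_{e_i}`,
`x_{e_i} ↦ √(1−η_i) x_i + √η_i x_{e_i}`, `p_{e_i} ↦ √(1−η_i) p_i + √η_i p_{e_i}`. -/
noncomputable def Mloss (η₁ η₂ : ℝ) : Matrix (Fin 8) (Fin 8) ℝ :=
  !![Real.sqrt η₁, 0, 0, 0, -Real.sqrt (1-η₁), 0, 0, 0;
     0, Real.sqrt η₁, 0, 0, 0, -Real.sqrt (1-η₁), 0, 0;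
     0, 0, Real.sqrt η₂, 0, 0, 0, -Real.sqrt (1-η₂), 0;
     0, 0, 0, Real.sqrt η₂, 0, 0, 0, -Real.sqrt (1-η₂);
     Real.sqrt (1-η₁), 0, 0, 0, Real.sqrt η₁, 0, 0, 0;
     0, Real.sqrt (1-η₁), 0, 0, 0, Real.sqrt η₁, 0, 0;
     0, 0, Real.sqrt (1-η₂), 0, 0, 0, Real.sqrt η₂, 0;
     0, 0, 0, Real.sqrt (1-η₂), 0, 0, 0, Real.sqrt η₂]

/-- Reduced covariance matrix `γ'(φ)` of the two interferometer modes after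
phase shift and photon loss. -/
noncomputable def gammaOut (r η₁ η₂ φ : ℝ) : Matrix (Fin 4) (Fin 4) ℝ :=
  let d₁ : ℝ := 1 + 2 * η₁ * Real.sinh r ^ 2
  let d₂ : ℝ := 1 + 2 * η₂ * Real.sinh r ^ 2
  let a : ℝ := Real.sqrt (η₁ * η₂) * Real.sinh (2*r)
  !![d₁, 0, a * Real.cos φ, -a * Real.sin φ;
     0, d₁, -a * Real.sin φ, -a * Real.cos φ;
     a * Real.cos φ, -a * Real.sin φ, d₂, 0;
     -a * Real.sin φ, -a * Real.cos φ, 0, d₂]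

set_option maxHeartbeats 4000000 in
/-- the upper-left 4×4 block of
`M_loss · M_φ · (γ₀ ⊕ I₄) · M_φᵀ · M_lossᵀ` is exactly `γ'(φ)`. -/
theorem stmt_9 (r η₁ η₂ φ : ℝ) (h1 : η₁ ∈ Set.Icc (0 : ℝ) 1) (h2 : η₂ ∈ Set.Icc (0 : ℝ) 1) :
    ∀ i j : Fin 4,
      (Mloss η₁ η₂ * Mphase φ * gammaIn r * (Mphase φ)ᵀ * (Mloss η₁ η₂)ᵀ)
          (Fin.castLE (by norm_num) i) (Fin.castLE (by norm_num) j) =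
        gammaOut r η₁ η₂ φ i j := by
  intro i j
  obtain ⟨h10, h11⟩ := h1
  obtain ⟨h20, h21⟩ := h2
  have e1 := Real.sq_sqrt h10
  have e2 := Real.sq_sqrt h20
  have f1 := Real.sq_sqrt (sub_nonneg.2 h11)
  have f2 := Real.sq_sqrt (sub_nonneg.2 h21)
  have hc : Real.cosh (2 * r) = 1 + 2 * Real.sinh r ^ 2 := by
    rw [Real.cosh_two_mul, Real.cosh_sq]; ring
  have ht := Real.sin_sq_add_cos_sq φ
  have hs := Real.sqrt_mul h10 η₂
  fin_cases i <;> fin_cases j <;>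
    simp [Mloss, Mphase, gammaIn, gammaOut, Matrix.mul_apply, Matrix.vecMul, dotProduct,
      Fin.sum_univ_succ, Fin.castLE, hc, hs] <;>
    clear hc hs <;>
    generalize √η₁ = s₁, √η₂ = s₂, √(1 - η₁) = t₁, √(1 - η₂) = t₂ at e1 e2 f1 f2 ⊢ <;>
    grind
end

section
/- Let n > 0, η₁, η₂ ∈ (0,1], and define ω(φ) := 2η₁η₂(n+2)cos²φ + (η₁+η₂)(2−η₁−η₂) and P(φ) := √(2/(n ω(φ) + 2)). Then for every φ ∈ ℝ with sin(2φ) ≠ 0, the error-propagation quantity (1 − P(φ)²) / (P′(φ))² equals ω(φ)(n ω(φ) + 2)² / (2 η₁² η₂² n (n+2)² sin²(2φ)). -/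
open Real

/-- error-propagation formula for the lossy parity signal
`P(φ) = √(2/(nω(φ)+2))`, `ω(φ) = 2η₁η₂(n+2)cos²φ + (η₁+η₂)(2−η₁−η₂)`:
whenever `sin(2φ) ≠ 0`,
`(1 − P(φ)²)/(P′(φ))² = ω(φ)(nω(φ)+2)²/(2η₁²η₂²n(n+2)² sin²(2φ))`. -/
theorem stmt_10 (n η₁ η₂ : ℝ) (hn : 0 < n)
    (h1 : η₁ ∈ Set.Ioc (0 : ℝ) 1) (h2 : η₂ ∈ Set.Ioc (0 : ℝ) 1)
    (ω : ℝ → ℝ)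
    (hω : ω = fun φ => 2 * η₁ * η₂ * (n + 2) * Real.cos φ ^ 2 + (η₁ + η₂) * (2 - η₁ - η₂))
    (P : ℝ → ℝ) (hP : P = fun φ => Real.sqrt (2 / (n * ω φ + 2))) :
    ∀ φ : ℝ, Real.sin (2 * φ) ≠ 0 →
      (1 - P φ ^ 2) / (deriv P φ) ^ 2 =
        ω φ * (n * ω φ + 2) ^ 2 /
          (2 * η₁ ^ 2 * η₂ ^ 2 * n * (n + 2) ^ 2 * Real.sin (2 * φ) ^ 2) := by
  obtain ⟨h1, h1'⟩ := h1
  obtain ⟨h2, h2'⟩ := h2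
  intro φ hs
  have hω0 : 0 ≤ ω φ := by
    rw [hω]
    have : 0 ≤ 2 - η₁ - η₂ := by linarith
    positivity
  have hω' : HasDerivAt ω (-(2 * η₁ * η₂ * (n + 2) * Real.sin (2 * φ))) φ := by
    rw [hω]
    refine ((((Real.hasDerivAt_cos φ).pow 2).const_mul (2 * η₁ * η₂ * (n + 2))).add_const
      ((η₁ + η₂) * (2 - η₁ - η₂))).congr_deriv ?_
    rw [Real.sin_two_mul]
    push_cast
    ring
  have hD : 0 < n * ω φ + 2 := by positivity
  have hD' := (hω'.const_mul n).add_const 2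
  have hP' := ((hD'.inv hD.ne').const_mul 2).sqrt (by simp only [Pi.inv_apply]; positivity)
  have hPsq : P φ ^ 2 = 2 / (n * ω φ + 2) := by
    rw [hP]
    exact Real.sq_sqrt (by positivity)
  have hderiv : deriv P φ ^ 2 =
      2 * (n * η₁ * η₂ * (n + 2) * Real.sin (2 * φ)) ^ 2 / (n * ω φ + 2) ^ 3 := by
    have hfun : P = fun x => Real.sqrt (2 * (n * ω x + 2)⁻¹) := by
      simp only [hP, div_eq_mul_inv]
    have hd : HasDerivAt P _ φ := hfun ▸ hP'
    rw [hd.deriv, div_pow, mul_pow 2 (Real.sqrt _), Real.sq_sqrt (by simp only [Pi.inv_apply]; positivity)]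
    simp only [Pi.inv_apply]
    field_simp
  rw [hPsq, hderiv]
  have hn2 : n + 2 ≠ 0 := by positivity
  field_simp
  ring
end

section
/- Let n > 0 and define the ideal (lossless) parity phase error Δφ̃(φ) := (1 + n(n+2)cos²φ) / (sin φ · √(n(n+2))) for φ ∈ (0, π/2]. Then Δφ̃ is strictly decreasing on (0, π/2], and its minimum value, attained at φ = π/2, equals 1/√(n(n+2)), i.e. the lossless parity measurement at φ = π/2 saturates the modified Heisenberg limit 1/√(n(n+2)). -/
open Real

/-- the ideal (lossless) parity phase error
`Δφ̃(φ) = (1 + n(n+2)cos²φ)/(sin φ · √(n(n+2)))` is strictly decreasing on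
`(0, π/2]`, and its minimum over that interval, attained at `φ = π/2`, equals
`1/√(n(n+2))` (the modified Heisenberg limit). -/
theorem stmt_12 (n : ℝ) (hn : 0 < n)
    (Δφ : ℝ → ℝ)
    (hΔφ : Δφ = fun φ =>
      (1 + n * (n + 2) * Real.cos φ ^ 2) / (Real.sin φ * Real.sqrt (n * (n + 2)))) :
    StrictAntiOn Δφ (Set.Ioc 0 (Real.pi / 2)) ∧
      Δφ (Real.pi / 2) = 1 / Real.sqrt (n * (n + 2)) ∧
      ∀ φ ∈ Set.Ioc 0 (Real.pi / 2), Δφ (Real.pi / 2) ≤ Δφ φ := by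
  have hk : 0 < n * (n + 2) := by positivity
  have hr : 0 < Real.sqrt (n * (n + 2)) := Real.sqrt_pos.mpr hk
  have hanti : StrictAntiOn Δφ (Set.Ioc 0 (Real.pi / 2)) := by
    intro a ha b hb hab
    have hsa : 0 < Real.sin a := Real.sin_pos_of_pos_of_lt_pi ha.1 (by linarith [ha.2, Real.pi_pos])
    have hlt : Real.sin a < Real.sin b :=
      Real.sin_lt_sin_of_lt_of_le_pi_div_two (by linarith [ha.1, Real.pi_pos]) hb.2 hab
    have hsb : 0 < Real.sin b := hsa.trans hlt
    subst hΔφ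
    simp only [Real.cos_sq']
    rw [div_lt_div_iff₀ (mul_pos hsb hr) (mul_pos hsa hr), ← sub_pos]
    have hd : 0 < Real.sin b - Real.sin a := sub_pos.mpr hlt
    have hpos : 0 < Real.sqrt (n * (n + 2)) * (Real.sin b - Real.sin a) *
        (1 + n * (n + 2) + n * (n + 2) * (Real.sin a * Real.sin b)) := by positivity
    exact hpos.trans_eq (by ring)
  have hmem : Real.pi / 2 ∈ Set.Ioc 0 (Real.pi / 2) := ⟨by positivity, le_rfl⟩
  exact ⟨hanti, by simp [hΔφ], fun φ hφ => hanti.antitoneOn hφ hmem hφ.2⟩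
end

section
/- Let n > 0 and η₁, η₂ ∈ (0,1] with η₁ + η₂ < 2 (i.e. nonzero loss in at least one arm). Define ω(φ) := 2η₁η₂(n+2)cos²φ + (η₁+η₂)(2−η₁−η₂) and Δφ²(φ) := ω(φ)(n ω(φ)+2)² / (2 η₁² η₂² n (n+2)² sin²(2φ)). Then Δφ²(φ) → +∞ as φ → π/2 (within (0, π/2)) and also as φ → 0 (within (0, π/2)). In particular, in the presence of any loss, blindly performing the parity measurement at the lossless optimum φ = π/2 yields an unbounded phase-estimation error. -/
open Real Filter

/-- A quotient of continuous functions diverges to `+∞` at a zero of the denominator, along a set on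
which the denominator is positive, provided the numerator is positive there. -/
lemma tendsto_div_atTop_of_continuous {f g : ℝ → ℝ} (hf : Continuous f) (hg : Continuous g)
    {s : Set ℝ} {a : ℝ} (hfa : 0 < f a) (hga : g a = 0) (hgs : ∀ x ∈ s, 0 < g x) :
    Tendsto (fun x => f x / g x) (nhdsWithin a s) atTop := by
  have hg0 : Tendsto g (nhdsWithin a s) (nhdsWithin 0 (Set.Ioi 0)) :=
    tendsto_nhdsWithin_iff.2 ⟨hga ▸ (hg.tendsto a).mono_left nhdsWithin_le_nhds,
      eventually_nhdsWithin_of_forall hgs⟩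
  simpa only [div_eq_mul_inv, Pi.inv_apply] using
    ((hf.tendsto a).mono_left nhdsWithin_le_nhds).pos_mul_atTop hfa hg0.inv_tendsto_nhdsGT_zero

/-- with nonzero loss (`η₁ + η₂ < 2`), the lossy parity-measurement
phase variance `Δφsq(φ) = ω(φ)(nω(φ)+2)²/(2η₁²η₂²n(n+2)² sin²(2φ))`, where
`ω(φ) = 2η₁η₂(n+2)cos²φ + (η₁+η₂)(2−η₁−η₂)`, diverges to `+∞` as `φ → π/2`
and as `φ → 0` within `(0, π/2)`. -/
theorem stmt_13 (n η₁ η₂ : ℝ) (hn : 0 < n)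
    (h1 : η₁ ∈ Set.Ioc (0 : ℝ) 1) (h2 : η₂ ∈ Set.Ioc (0 : ℝ) 1)
    (hloss : η₁ + η₂ < 2)
    (ω : ℝ → ℝ)
    (hω : ω = fun φ => 2 * η₁ * η₂ * (n + 2) * Real.cos φ ^ 2 + (η₁ + η₂) * (2 - η₁ - η₂))
    (Δφsq : ℝ → ℝ)
    (hΔφsq : Δφsq = fun φ => ω φ * (n * ω φ + 2) ^ 2 /
      (2 * η₁ ^ 2 * η₂ ^ 2 * n * (n + 2) ^ 2 * Real.sin (2 * φ) ^ 2)) :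
    Tendsto Δφsq (nhdsWithin (Real.pi / 2) (Set.Ioo 0 (Real.pi / 2))) atTop ∧
      Tendsto Δφsq (nhdsWithin 0 (Set.Ioo 0 (Real.pi / 2))) atTop := by
  obtain ⟨h1, -⟩ := h1
  obtain ⟨h2, -⟩ := h2
  have hω_pos (φ : ℝ) : 0 < ω φ := by
    have : 0 < (η₁ + η₂) * (2 - η₁ - η₂) := mul_pos (by linarith) (by linarith)
    rw [hω]
    positivity
  have hω_cont : Continuous ω := by
    rw [hω]
    fun_prop
  have key (a : ℝ) (ha : Real.sin (2 * a) = 0) :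
      Tendsto Δφsq (nhdsWithin a (Set.Ioo 0 (Real.pi / 2))) atTop := by
    rw [hΔφsq]
    refine tendsto_div_atTop_of_continuous (by fun_prop) (by fun_prop) ?_ (by simp [ha]) ?_
    · have := hω_pos a
      positivity
    · rintro φ ⟨hφ0, hφ1⟩
      have : 0 < Real.sin (2 * φ) := Real.sin_pos_of_pos_of_lt_pi (by linarith) (by linarith)
      positivity
  exact ⟨key _ (by rw [mul_div_cancel₀ _ two_ne_zero, Real.sin_pi]), key 0 (by simp)⟩
end
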